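/- arXiv:2211.11003 — 2 statements merged into one kernel-verified Lean document; each statement's English description precedes it below -/
import Mathlib

section
/- Accuracy of the semi-exact flow: Suppose U satisfies assumptions A1–A2 with constant L > 0, let T > 0 satisfy L·T² ≤ 1/8, and let h > 0 be such that T/h is a positive integer. Then for all x, v ∈ ℝ^d and all k ∈ ℕ with t_k = k·h ≤ T, |q̄_{t_k}(x,v) − q_{t_k}(x,v)| ≤ 2 · e^{5/8} · L^{1/2} · (|v| + L^{1/2}·|x|) · h². -/
open MeasureTheory ProbabilityTheory Real
open scoped ENNReal RealInnerProductSpace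

noncomputable section

variable {d : ℕ}

/-- One step of the semi-exact flow: the force used on a stratum is the average
`-(1/h)·∫₀ʰ ∇U(q̄ + s·p̄) ds` of the potential force along the free flight. -/
def semiStep (gU : EuclideanSpace ℝ (Fin d) → EuclideanSpace ℝ (Fin d)) (h : ℝ)
    (z : EuclideanSpace ℝ (Fin d) × EuclideanSpace ℝ (Fin d)) :
    EuclideanSpace ℝ (Fin d) × EuclideanSpace ℝ (Fin d) :=
  (z.1 + h • z.2 + (h ^ 2 / 2) • (-(h⁻¹ • ∫ s in Set.Ioc (0 : ℝ) h, gU (z.1 + s • z.2))),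
    z.2 + h • (-(h⁻¹ • ∫ s in Set.Ioc (0 : ℝ) h, gU (z.1 + s • z.2))))

/-- Grid values `(q̄_{t_k}, p̄_{t_k})` of the semi-exact flow. -/
def semiGrid (gU : EuclideanSpace ℝ (Fin d) → EuclideanSpace ℝ (Fin d)) (h : ℝ)
    (z₀ : EuclideanSpace ℝ (Fin d) × EuclideanSpace ℝ (Fin d)) (k : ℕ) :
    EuclideanSpace ℝ (Fin d) × EuclideanSpace ℝ (Fin d) :=
  (semiStep gU h)^[k] z₀

section

variable {gU : EuclideanSpace ℝ (Fin d) → EuclideanSpace ℝ (Fin d)} {L h : ℝ}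

lemma continuous_of_norm_sub_le (hL : 0 < L)
    (hLip : ∀ x y, ‖gU x - gU y‖ ≤ L * ‖x - y‖) : Continuous gU :=
  (LipschitzWith.of_dist_le_mul (K := ⟨L, hL.le⟩) fun x y => by
    rw [dist_eq_norm, dist_eq_norm]
    exact hLip x y).continuous

lemma gradient_eq_zero_of_min {U : EuclideanSpace ℝ (Fin d) → ℝ}
    {x g : EuclideanSpace ℝ (Fin d)} (hg : HasGradientAt U g x) (hmin : ∀ y, U x ≤ U y) :
    g = 0 := by
  have hloc : IsLocalMin U x := Filter.Eventually.of_forall hmin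
  simpa using hloc.hasFDerivAt_eq_zero hg.hasFDerivAt

lemma norm_image_sub_le_of_norm_deriv_le_Icc {E : Type*} [NormedAddCommGroup E]
    [NormedSpace ℝ E] {f f' : ℝ → E} {C b : ℝ} (hf : ∀ t, HasDerivAt f (f' t) t)
    (bound : ∀ t ∈ Set.Icc 0 b, ‖f' t‖ ≤ C) {s : ℝ} (hs : s ∈ Set.Icc 0 b) :
    ‖f s - f 0‖ ≤ C * s := by
  simpa using norm_image_sub_le_of_norm_deriv_le_segment' (a := 0) (b := b)
    (fun t _ => (hf t).hasDerivWithinAt)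
    (fun t ht => bound t ⟨ht.1, ht.2.le⟩) s hs

/-- Growth of the exact flow in the energy-scaled norms. -/
lemma hamiltonian_flow_bound (hL : 0 < L) (hgrowth : ∀ x, ‖gU x‖ ≤ L * ‖x‖)
    {q p : ℝ → EuclideanSpace ℝ (Fin d)}
    (hq : ∀ t, HasDerivAt q (p t) t) (hp : ∀ t, HasDerivAt p (-gU (q t)) t)
    {t : ℝ} (ht : 0 ≤ t) :
    √L * ‖q t‖ ≤ (‖p 0‖ + √L * ‖q 0‖) * exp (√L * t) ∧
      ‖p t‖ ≤ (‖p 0‖ + √L * ‖q 0‖) * exp (√L * t) := by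
  have ha : 0 ≤ √L := sqrt_nonneg L
  have haL : √L * √L = L := mul_self_sqrt hL.le
  have hderiv (s : ℝ) : HasDerivAt (fun s => (√L • q s, p s)) (√L • p s, -gU (q s)) s :=
    ((hq s).fun_const_smul _).prodMk (hp s)
  have hnorm (s : ℝ) : ‖√L • q s‖ = √L * ‖q s‖ := by
    rw [norm_smul, norm_of_nonneg ha]
  have key := norm_le_gronwallBound_of_norm_deriv_right_le
    (f := fun s => (√L • q s, p s)) (f' := fun s => (√L • p s, -gU (q s)))
    (δ := ‖p 0‖ + √L * ‖q 0‖) (K := √L) (ε := 0) (a := 0) (b := t)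
    (fun s _ => (hderiv s).continuousAt.continuousWithinAt)
    (fun s _ => (hderiv s).hasDerivWithinAt)
    (by
      rw [Prod.norm_def, hnorm]
      exact max_le (by linarith [norm_nonneg (p 0)])
        (by linarith [mul_nonneg ha (norm_nonneg (q 0))]))
    (by
      intro s _
      rw [add_zero, Prod.norm_def, Prod.norm_def]
      refine max_le ?_ ?_
      · rw [norm_smul, norm_of_nonneg ha]
        exact mul_le_mul_of_nonneg_left (le_max_right _ _) ha
      · rw [norm_neg]
        calc ‖gU (q s)‖ ≤ L * ‖q s‖ := hgrowth _
          _ = √L * ‖√L • q s‖ := by rw [hnorm, ← mul_assoc, haL]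
          _ ≤ _ := mul_le_mul_of_nonneg_left (le_max_left _ _) ha)
    t ⟨ht, le_rfl⟩
  rw [gronwallBound_ε0, sub_zero, Prod.norm_def, hnorm] at key
  exact ⟨(le_max_left _ _).trans key, (le_max_right _ _).trans key⟩

lemma integrableOn_comp_free_flight (hgU : Continuous gU)
    (x v : EuclideanSpace ℝ (Fin d)) :
    IntegrableOn (fun s : ℝ => gU (x + s • v)) (Set.Ioc 0 h) :=
  (by fun_prop : Continuous fun s : ℝ => gU (x + s • v)).integrableOn_Ioc

lemma norm_setIntegral_Ioc_le {E : Type*} [NormedAddCommGroup E] [NormedSpace ℝ E]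
    {f : ℝ → E} {C : ℝ} (hh : 0 ≤ h) (hf : ∀ s ∈ Set.Ioc 0 h, ‖f s‖ ≤ C) :
    ‖∫ s in Set.Ioc 0 h, f s‖ ≤ C * h := by
  simpa [Measure.real, hh] using
    norm_setIntegral_le_of_norm_le_const (μ := volume) (by simp) hf

lemma semiStep_lipschitz (hL : 0 < L) (hLip : ∀ x y, ‖gU x - gU y‖ ≤ L * ‖x - y‖)
    (hh : 0 < h) (hLh : √L * h ≤ 3 / 8)
    (z w : EuclideanSpace ℝ (Fin d) × EuclideanSpace ℝ (Fin d)) :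
    √L * ‖(semiStep gU h z).1 - (semiStep gU h w).1‖
        + ‖(semiStep gU h z).2 - (semiStep gU h w).2‖
      ≤ exp (3 / 2 * (√L * h)) * (√L * ‖z.1 - w.1‖ + ‖z.2 - w.2‖) := by
  have hcont := continuous_of_norm_sub_le hL hLip
  have ha : 0 ≤ √L := sqrt_nonneg L
  have haL : √L ^ 2 = L := sq_sqrt hL.le
  set I := ∫ s in Set.Ioc (0 : ℝ) h, gU (z.1 + s • z.2) with hI
  set J := ∫ s in Set.Ioc (0 : ℝ) h, gU (w.1 + s • w.2) with hJ
  have hX := norm_nonneg (z.1 - w.1)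
  have hY := norm_nonneg (z.2 - w.2)
  set X := ‖z.1 - w.1‖
  set Y := ‖z.2 - w.2‖
  have hIJ : ‖I - J‖ ≤ L * (X + h * Y) * h := by
    rw [hI, hJ, ← integral_sub (integrableOn_comp_free_flight hcont _ _)
      (integrableOn_comp_free_flight hcont _ _)]
    refine norm_setIntegral_Ioc_le hh.le fun s hs => (hLip _ _).trans ?_
    gcongr
    calc ‖z.1 + s • z.2 - (w.1 + s • w.2)‖ = ‖(z.1 - w.1) + s • (z.2 - w.2)‖ := by
          congr 1; module
      _ ≤ X + ‖s • (z.2 - w.2)‖ := norm_add_le _ _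
      _ = X + s * Y := by rw [norm_smul, norm_of_nonneg hs.1.le]
      _ ≤ X + h * Y := by gcongr; exact hs.2
  have h1 : ‖(semiStep gU h z).1 - (semiStep gU h w).1‖
      ≤ X + h * Y + h / 2 * ‖I - J‖ := by
    have : (semiStep gU h z).1 - (semiStep gU h w).1
        = (z.1 - w.1) + h • (z.2 - w.2) - (h / 2) • (I - J) := by
      simp only [semiStep, ← hI, ← hJ]
      match_scalars <;> field_simp
    rw [this]
    refine (norm_sub_le _ _).trans (add_le_add ((norm_add_le _ _).trans ?_) ?_)
    · rw [norm_smul, norm_of_nonneg hh.le]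
    · rw [norm_smul, norm_of_nonneg (by positivity)]
  have h2 : ‖(semiStep gU h z).2 - (semiStep gU h w).2‖ ≤ Y + ‖I - J‖ := by
    have : (semiStep gU h z).2 - (semiStep gU h w).2 = (z.2 - w.2) - (I - J) := by
      simp only [semiStep, ← hI, ← hJ]
      match_scalars <;> field_simp
    rw [this]
    exact norm_sub_le _ _
  have hexp : 1 + 3 / 2 * (√L * h) ≤ exp (3 / 2 * (√L * h)) := by
    linarith [add_one_le_exp (3 / 2 * (√L * h))]
  have hτ : 0 ≤ √L * h := by positivity
  rw [← haL] at hIJ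
  set a := √L
  set τ := a * h with hτd
  have hD : ‖I - J‖ ≤ τ * (a * X + τ * Y) := hIJ.trans_eq (by rw [hτd]; ring)
  have hpoly : τ + τ ^ 2 / 2 ≤ 3 / 2 * τ := by nlinarith
  have hpoly' : τ + τ ^ 2 + τ ^ 3 / 2 ≤ 3 / 2 * τ := by
    nlinarith [mul_nonneg hτ hτ, mul_nonneg (mul_nonneg hτ hτ) (sub_nonneg.2 hLh)]
  calc _ ≤ a * (X + h * Y + h / 2 * ‖I - J‖) + (Y + ‖I - J‖) := by gcongr
    _ = a * X + τ * Y + Y + (τ / 2 + 1) * ‖I - J‖ := by rw [hτd]; ring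
    _ ≤ a * X + τ * Y + Y + (τ / 2 + 1) * (τ * (a * X + τ * Y)) := by gcongr
    _ = (1 + (τ + τ ^ 2 / 2)) * (a * X) + (1 + (τ + τ ^ 2 + τ ^ 3 / 2)) * Y := by ring
    _ ≤ (1 + 3 / 2 * τ) * (a * X) + (1 + 3 / 2 * τ) * Y := by gcongr
    _ = (1 + 3 / 2 * τ) * (a * X + Y) := by ring
    _ ≤ _ := by gcongr

/-- Local error of one semi-exact step, given velocity and force bounds along the exact flow. -/
lemma semiStep_local_error (hL : 0 < L) (hLip : ∀ x y, ‖gU x - gU y‖ ≤ L * ‖x - y‖)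
    (hh : 0 < h) {q p : ℝ → EuclideanSpace ℝ (Fin d)}
    (hq : ∀ t, HasDerivAt q (p t) t) (hp : ∀ t, HasDerivAt p (-gU (q t)) t) {P G : ℝ}
    (hP : ∀ s ∈ Set.Icc 0 h, ‖p s‖ ≤ P) (hG : ∀ s ∈ Set.Icc 0 h, ‖gU (q s)‖ ≤ G) :
    ‖(semiStep gU h (q 0, p 0)).1 - q h‖ ≤ 2 * L * P * h ^ 3 ∧
      ‖(semiStep gU h (q 0, p 0)).2 - p h‖ ≤ L * G * h ^ 3 := by
  have hcont := continuous_of_norm_sub_le hL hLip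
  have h0 : (0 : ℝ) ∈ Set.Icc 0 h := ⟨le_rfl, hh.le⟩
  have h1 : h ∈ Set.Icc 0 h := ⟨hh.le, le_rfl⟩
  have hP0 : 0 ≤ P := (norm_nonneg _).trans (hP 0 h0)
  have hG0 : 0 ≤ G := (norm_nonneg _).trans (hG 0 h0)
  have hqcont : Continuous q := continuous_iff_continuousAt.2 fun t => (hq t).continuousAt
  set I := ∫ s in Set.Ioc (0 : ℝ) h, gU (q 0 + s • p 0) with hI
  constructor
  · have hq0 (s : ℝ) (hs : s ∈ Set.Icc 0 h) : ‖gU (q s) - gU (q 0)‖ ≤ L * (P * h) := by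
      refine (hLip _ _).trans ?_
      gcongr
      refine (norm_image_sub_le_of_norm_deriv_le_Icc hq hP hs).trans ?_
      gcongr
      exact hs.2
    have hIq0 : ‖h⁻¹ • I - gU (q 0)‖ ≤ L * (P * h) := by
      have : h⁻¹ • I - gU (q 0)
          = h⁻¹ • ∫ s in Set.Ioc (0 : ℝ) h, (gU (q 0 + s • p 0) - gU (q 0)) := by
        rw [integral_sub (integrableOn_comp_free_flight hcont _ _)
          continuous_const.integrableOn_Ioc, ← hI, smul_sub]
        simp [Measure.real, hh.le, smul_smul, hh.ne']
      rw [this, norm_smul, norm_of_nonneg (by positivity), inv_mul_le_iff₀ hh, mul_comm h]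
      refine norm_setIntegral_Ioc_le hh.le fun s hs => (hLip _ _).trans ?_
      rw [add_sub_cancel_left, norm_smul, norm_of_nonneg hs.1.le, mul_comm s]
      gcongr
      exacts [hs.1.le, hP 0 h0, hs.2]
    have hv (s : ℝ) (hs : s ∈ Set.Icc 0 h) :
        ‖p s - p 0 + s • (h⁻¹ • I)‖ ≤ 2 * L * P * h ^ 2 := by
      have hd (t : ℝ) : HasDerivAt (fun s => p s + s • (h⁻¹ • I))
          (-gU (q t) + h⁻¹ • I) t := by
        simpa using (hp t).fun_add ((hasDerivAt_id t).smul_const (h⁻¹ • I))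
      have hb (t : ℝ) (ht : t ∈ Set.Icc 0 h) :
          ‖-gU (q t) + h⁻¹ • I‖ ≤ L * (P * h) + L * (P * h) := by
        rw [show -gU (q t) + h⁻¹ • I = (h⁻¹ • I - gU (q 0)) - (gU (q t) - gU (q 0)) by abel]
        exact (norm_sub_le _ _).trans (add_le_add hIq0 (hq0 t ht))
      have := norm_image_sub_le_of_norm_deriv_le_Icc hd hb hs
      rw [zero_smul, add_zero, add_sub_right_comm] at this
      refine this.trans ?_
      calc (L * (P * h) + L * (P * h)) * s ≤ (L * (P * h) + L * (P * h)) * h := by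
            gcongr; exact hs.2
        _ = _ := by ring
    have hd (t : ℝ) : HasDerivAt (fun s => q s - s • p 0 + (s ^ 2 / 2) • (h⁻¹ • I))
        (p t - p 0 + t • (h⁻¹ • I)) t := by
      have hsq : HasDerivAt (fun s : ℝ => s ^ 2 / 2) t t := by
        simpa using (hasDerivAt_pow 2 t).div_const 2
      simpa using ((hq t).fun_sub ((hasDerivAt_id t).smul_const (p 0))).fun_add
        (hsq.smul_const (h⁻¹ • I))
    have := norm_image_sub_le_of_norm_deriv_le_Icc hd hv h1
    rw [norm_sub_rev]
    refine Eq.trans_le (congrArg norm ?_) (this.trans_eq (by ring))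
    simp only [semiStep, ← hI]
    module
  · have hfree (s : ℝ) (hs : s ∈ Set.Icc 0 h) : ‖q s - (q 0 + s • p 0)‖ ≤ G * h ^ 2 := by
      have hv (s : ℝ) (hs : s ∈ Set.Icc 0 h) : ‖p s - p 0‖ ≤ G * h := by
        refine (norm_image_sub_le_of_norm_deriv_le_Icc hp
          (fun t ht => (norm_neg _).trans_le (hG t ht)) hs).trans ?_
        gcongr
        exact hs.2
      have hd (t : ℝ) : HasDerivAt (fun s => q s - s • p 0) (p t - p 0) t := by
        simpa using (hq t).fun_sub ((hasDerivAt_id t).smul_const (p 0))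
      have := norm_image_sub_le_of_norm_deriv_le_Icc hd hv hs
      rw [zero_smul, sub_zero, sub_right_comm, sub_sub] at this
      refine this.trans ?_
      calc G * h * s ≤ G * h * h := by gcongr; exact hs.2
        _ = _ := by ring
    have hint : ∫ s in Set.Ioc (0 : ℝ) h, gU (q s) = -(p h - p 0) := by
      have := intervalIntegral.integral_eq_sub_of_hasDerivAt (a := 0) (b := h)
        (fun t _ => hp t) (Continuous.intervalIntegrable (by fun_prop) _ _)
      rw [← this, intervalIntegral.integral_of_le hh.le, integral_neg, neg_neg]
    have : (semiStep gU h (q 0, p 0)).2 - p h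
        = ∫ s in Set.Ioc (0 : ℝ) h, (gU (q s) - gU (q 0 + s • p 0)) := by
      rw [integral_sub (by fun_prop : Continuous fun s => gU (q s)).integrableOn_Ioc
        (integrableOn_comp_free_flight hcont _ _), hint]
      simp only [semiStep, ← hI]
      match_scalars <;> field_simp
    rw [this]
    refine (norm_setIntegral_Ioc_le (C := L * (G * h ^ 2)) hh.le fun s hs => ?_).trans_eq
      (by ring)
    refine (hLip _ _).trans ?_
    gcongr
    exact hfree s ⟨hs.1.le, hs.2⟩

lemma semiGrid_error (hL : 0 < L) (hLip : ∀ x y, ‖gU x - gU y‖ ≤ L * ‖x - y‖)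
    (hg0 : gU 0 = 0) (hh : 0 < h) (hLh : √L * h ≤ 3 / 8)
    {q p : ℝ → EuclideanSpace ℝ (Fin d)}
    (hq : ∀ t, HasDerivAt q (p t) t) (hp : ∀ t, HasDerivAt p (-gU (q t)) t)
    {T : ℝ} (k : ℕ) (hk : k * h ≤ T) :
    √L * ‖(semiGrid gU h (q 0, p 0) k).1 - q (k * h)‖
        + ‖(semiGrid gU h (q 0, p 0) k).2 - p (k * h)‖
      ≤ k * exp (3 / 2 * (√L * (k * h))) *
        (3 * ((‖p 0‖ + √L * ‖q 0‖) * exp (√L * T)) * (√L * h) ^ 3) := by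
  have ha : 0 ≤ √L := sqrt_nonneg L
  have haL : √L ^ 2 = L := sq_sqrt hL.le
  have hgrowth (x : EuclideanSpace ℝ (Fin d)) : ‖gU x‖ ≤ L * ‖x‖ := by
    simpa [hg0] using hLip x 0
  set M := (‖p 0‖ + √L * ‖q 0‖) * exp (√L * T) with hM
  have hM0 : 0 ≤ M := by positivity
  have hbound (t : ℝ) (ht : 0 ≤ t) (htT : t ≤ T) : √L * ‖q t‖ ≤ M ∧ ‖p t‖ ≤ M := by
    have hmono : (‖p 0‖ + √L * ‖q 0‖) * exp (√L * t) ≤ M := by rw [hM]; gcongr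
    exact (hamiltonian_flow_bound hL hgrowth hq hp ht).imp (·.trans hmono) (·.trans hmono)
  induction k with
  | zero => simp [semiGrid]
  | succ k ih =>
    have hk' : k * h + h ≤ T := by push_cast at hk; linarith
    specialize ih (by linarith)
    have hkh : 0 ≤ k * h := by positivity
    set t := k * h with ht
    have ht' : ((k + 1 : ℕ) : ℝ) * h = t + h := by push_cast; ring
    set z := semiGrid gU h (q 0, p 0) k with hz
    have hz' : semiGrid gU h (q 0, p 0) (k + 1) = semiStep gU h z := by
      simp only [hz, semiGrid, Function.iterate_succ_apply']
    have hloc := semiStep_local_error hL hLip hh (q := fun s => q (t + s))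
      (p := fun s => p (t + s)) (P := M) (G := √L * M)
      (fun s => (hq (t + s)).comp_const_add t s) (fun s => (hp (t + s)).comp_const_add t s)
      (fun s hs => (hbound (t + s) (by linarith [hs.1]) (by linarith [hs.2])).2)
      (fun s hs => by
        have hb := (hbound (t + s) (by linarith [hs.1]) (by linarith [hs.2])).1
        calc ‖gU (q (t + s))‖ ≤ L * ‖q (t + s)‖ := hgrowth _
          _ = √L * (√L * ‖q (t + s)‖) := by rw [← mul_assoc, mul_self_sqrt hL.le]
          _ ≤ √L * M := by gcongr)
    simp only [add_zero] at hloc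
    have hlip := semiStep_lipschitz hL hLip hh hLh z (q t, p t)
    rw [hz', ht']
    set w := semiStep gU h (q t, p t)
    set δ := 3 * M * (√L * h) ^ 3 with hδ
    have hδ0 : 0 ≤ δ := by positivity
    have hlocal : √L * ‖w.1 - q (t + h)‖ + ‖w.2 - p (t + h)‖ ≤ δ := by
      calc _ ≤ √L * (2 * L * M * h ^ 3) + L * (√L * M) * h ^ 3 := by
            gcongr
            exacts [hloc.1, hloc.2]
        _ = 3 * M * (√L * √L ^ 2 * h ^ 3) := by rw [haL]; ring
        _ = δ := by rw [hδ]; ring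
    have htri := norm_sub_le_norm_sub_add_norm_sub (semiStep gU h z).1 w.1 (q (t + h))
    have htri' := norm_sub_le_norm_sub_add_norm_sub (semiStep gU h z).2 w.2 (p (t + h))
    have hexp : exp (3 / 2 * (√L * (t + h)))
        = exp (3 / 2 * (√L * h)) * exp (3 / 2 * (√L * t)) := by
      rw [← exp_add]; ring_nf
    have hone : 1 ≤ exp (3 / 2 * (√L * (t + h))) := one_le_exp (by positivity)
    calc _ ≤ √L * (‖(semiStep gU h z).1 - w.1‖ + ‖w.1 - q (t + h)‖)
          + (‖(semiStep gU h z).2 - w.2‖ + ‖w.2 - p (t + h)‖) := by gcongr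
      _ ≤ exp (3 / 2 * (√L * h)) * (√L * ‖z.1 - q t‖ + ‖z.2 - p t‖) + δ := by linarith
      _ ≤ exp (3 / 2 * (√L * h)) * (k * exp (3 / 2 * (√L * t)) * δ) + 1 * δ := by
        gcongr
        linarith
      _ ≤ exp (3 / 2 * (√L * h)) * (k * exp (3 / 2 * (√L * t)) * δ)
          + exp (3 / 2 * (√L * (t + h))) * δ := by gcongr
      _ = _ := by rw [hexp]; push_cast; ring

end

/-- **Accuracy of the semi-exact flow** (Lemma 3.3): under A1–A2, `L·T² ≤ 1/8`,
`T = n·h`, for all `(x, v)` and all `k` with `t_k = k·h ≤ T`,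
`|q̄_{t_k}(x,v) - q_{t_k}(x,v)| ≤ 2·e^{5/8}·L^{1/2}·(|v| + L^{1/2}·|x|)·h²`. -/
theorem semi_exact_accuracy
    (U : EuclideanSpace ℝ (Fin d) → ℝ)
    (gU : EuclideanSpace ℝ (Fin d) → EuclideanSpace ℝ (Fin d)) (L : ℝ) (hL : 0 < L)
    (hgrad : ∀ x, HasGradientAt U (gU x) x)
    (hU0 : U 0 = 0) (hUmin : ∀ x, U 0 ≤ U x)
    (hLip : ∀ x y, ‖gU x - gU y‖ ≤ L * ‖x - y‖)
    (T h : ℝ) (hT : 0 < T) (hh : 0 < h) (hLT : L * T ^ 2 ≤ 1 / 8)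
    (n : ℕ) (hn : 0 < n) (hTn : T = n * h)
    (x v : EuclideanSpace ℝ (Fin d))
    (q p : ℝ → EuclideanSpace ℝ (Fin d)) (hq0 : q 0 = x) (hp0 : p 0 = v)
    (hq : ∀ t, HasDerivAt q (p t) t) (hp : ∀ t, HasDerivAt p (-gU (q t)) t)
    (k : ℕ) (hk : (k : ℝ) * h ≤ T) :
    ‖(semiGrid gU h (x, v) k).1 - q (k * h)‖
      ≤ 2 * Real.exp (5/8) * Real.sqrt L * (‖v‖ + Real.sqrt L * ‖x‖) * h ^ 2 := by
  have hg0 : gU 0 = 0 := gradient_eq_zero_of_min (hgrad 0) hUmin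
  subst hq0 hp0
  have ha : 0 < √L := sqrt_pos.2 hL
  have haT : √L * T ≤ 3 / 8 := by
    refine abs_le_of_sq_le_sq' (b := 3 / 8) ?_ (by norm_num) |>.2
    rw [mul_pow, sq_sqrt hL.le]
    linarith
  have hhT : h ≤ T := by
    rw [hTn]
    exact le_mul_of_one_le_left hh.le (by exact_mod_cast hn)
  have hLh : √L * h ≤ 3 / 8 := (by gcongr : √L * h ≤ √L * T).trans haT
  have herr := semiGrid_error hL hLip hg0 hh hLh hq hp k hk
  set A := ‖p 0‖ + √L * ‖q 0‖ with hA
  have hA0 : 0 ≤ A := by positivity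
  have hexp : exp (3 / 2 * (√L * (k * h))) * exp (√L * T) ≤ 16 / 11 * exp (5 / 8) := by
    have h1 : exp (5 / 16) ≤ 16 / 11 := by
      have := one_sub_le_exp_neg (5 / 16)
      rw [exp_neg] at this
      have h2 := le_inv_of_le_inv₀ (by norm_num) this
      norm_num at h2
      exact h2
    calc exp (3 / 2 * (√L * (k * h))) * exp (√L * T)
        ≤ exp (3 / 2 * (√L * T)) * exp (√L * T) := by gcongr
      _ = exp (5 / 2 * (√L * T)) := by rw [← exp_add]; ring_nf
      _ ≤ exp (5 / 16 + 5 / 8) := exp_le_exp.2 (by linarith)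
      _ = exp (5 / 16) * exp (5 / 8) := exp_add _ _
      _ ≤ _ := by gcongr
  have hkτ : √L * (k * h) ≤ 3 / 8 := (by gcongr : √L * (k * h) ≤ √L * T).trans haT
  refine le_of_mul_le_mul_left ?_ ha
  calc _ ≤ _ := le_of_add_le_of_nonneg_left herr (norm_nonneg _)
    _ = (exp (3 / 2 * (√L * (k * h))) * exp (√L * T)) * (√L * (k * h)) *
          (3 * A * (√L * h) ^ 2) := by ring
    _ ≤ (16 / 11 * exp (5 / 8)) * (3 / 8) * (3 * A * (√L * h) ^ 2) := by gcongr
    _ = 18 / 11 * (exp (5 / 8) * (A * (√L * h) ^ 2)) := by ring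
    _ ≤ 2 * (exp (5 / 8) * (A * (√L * h) ^ 2)) := by gcongr; norm_num
    _ = _ := by ring

end
end

section
/- Mean-square bound on the discretization error of the force along one step: Suppose U satisfies assumptions A1–A2 with constant L > 0, let h > 0 satisfy L^{1/2}·h ≤ 1/12, and let 𝒰 ~ Uniform(0, h). For x, v ∈ ℝ^d, define F := −∇U, F_𝒰 := F(x + 𝒰·v), F₁ := (2/h²)·∫₀^h (h − s)·F(q_s(x,v)) ds, and F₂ := (1/h)·∫₀^h F(q_s(x,v)) ds. Then max( E|F₁ − F_𝒰|², E|F₂ − F_𝒰|² ) ≤ 11·L²·h²·( L²·h²·|x|² + |v|² ). -/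
open MeasureTheory ProbabilityTheory Real
open scoped ENNReal RealInnerProductSpace

noncomputable section

variable {d : ℕ}

/-- The uniform distribution on `(0, h)`. -/
def unif0h (h : ℝ) : Measure ℝ :=
  (ENNReal.ofReal h)⁻¹ • (volume.restrict (Set.Ioo (0 : ℝ) h))

lemma isProbabilityMeasure_unif0h {h : ℝ} (hh : 0 < h) : IsProbabilityMeasure (unif0h h) := by
  constructor
  have h0 : ENNReal.ofReal h ≠ 0 := by simpa using hh
  simp [unif0h, ENNReal.inv_mul_cancel h0 ENNReal.ofReal_ne_top]

lemma ae_unif0h_mem_Ioo (h : ℝ) : ∀ᵐ u ∂(unif0h h), u ∈ Set.Ioo 0 h :=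
  Measure.ae_smul_measure (ae_restrict_mem measurableSet_Ioo) _

/-- The gradient vanishes at a global minimum. -/
lemma HasGradientAt.eq_zero_of_forall_le {E : Type*} [NormedAddCommGroup E]
    [InnerProductSpace ℝ E] [CompleteSpace E] {U : E → ℝ} {g a : E}
    (hg : HasGradientAt U g a) (hmin : ∀ x, U a ≤ U x) : g = 0 := by
  have hloc : IsLocalMin U a := Filter.Eventually.of_forall hmin
  simpa using hloc.hasFDerivAt_eq_zero hg.hasFDerivAt

/-- Weighted averages of points within distance `C` of `c` are within distance `C` of `c`. -/
lemma norm_setIntegral_smul_sub_le {E : Type*} [NormedAddCommGroup E] [NormedSpace ℝ E]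
    [CompleteSpace E] {h C : ℝ} {w : ℝ → ℝ} {f : ℝ → E} {c : E}
    (hw : Continuous w) (hf : Continuous f)
    (hw0 : ∀ s ∈ Set.Ioc 0 h, 0 ≤ w s) (hw1 : ∫ s in Set.Ioc 0 h, w s = 1)
    (hfc : ∀ s ∈ Set.Ioc 0 h, ‖f s - c‖ ≤ C) :
    ‖(∫ s in Set.Ioc 0 h, w s • f s) - c‖ ≤ C := by
  have hc : c = ∫ s in Set.Ioc 0 h, w s • c := by rw [integral_smul_const, hw1, one_smul]
  have hsub : (∫ s in Set.Ioc 0 h, w s • f s) - c = ∫ s in Set.Ioc 0 h, w s • (f s - c) := by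
    conv_lhs => rw [hc]
    simp only [smul_sub]
    exact (integral_sub (hw.smul hf).integrableOn_Ioc
      (hw.smul continuous_const).integrableOn_Ioc).symm
  calc ‖(∫ s in Set.Ioc 0 h, w s • f s) - c‖
      ≤ ∫ s in Set.Ioc 0 h, w s * C := by
        rw [hsub]
        refine norm_integral_le_of_norm_le (hw.mul continuous_const).integrableOn_Ioc ?_
        filter_upwards [ae_restrict_mem measurableSet_Ioc] with s hs
        rw [norm_smul, Real.norm_of_nonneg (hw0 s hs)]
        exact mul_le_mul_of_nonneg_left (hfc s hs) (hw0 s hs)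
    _ = C := by rw [integral_mul_const, hw1, one_mul]

lemma integral_unif0h_norm_sq_le {E : Type*} [NormedAddCommGroup E] {h C : ℝ} (hh : 0 < h)
    {f : ℝ → E} (hf : ∀ u ∈ Set.Ioo 0 h, ‖f u‖ ≤ C) :
    ∫ u, ‖f u‖ ^ 2 ∂(unif0h h) ≤ C ^ 2 := by
  have := isProbabilityMeasure_unif0h hh
  have hbound := norm_integral_le_of_norm_le_const (μ := unif0h h) (f := fun u => ‖f u‖ ^ 2)
    (C := C ^ 2) (by
      filter_upwards [ae_unif0h_mem_Ioo h] with u hu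
      rw [Real.norm_of_nonneg (by positivity)]
      exact pow_le_pow_left₀ (norm_nonneg _) (hf u hu) 2)
  simpa using (le_abs_self _).trans hbound

/-- Short-time distance between the Hamiltonian flow and free transport. -/
lemma norm_hamiltonian_sub_transport_le {E : Type*} [NormedAddCommGroup E] [NormedSpace ℝ E]
    {g : E → E} {L h : ℝ} (hL : 0 < L) (hg : ∀ y, ‖g y‖ ≤ L * ‖y‖) (hh : 0 < h)
    (hLh : L * h ^ 2 ≤ 1 / 144) {q p : ℝ → E}
    (hq : ∀ t, HasDerivAt q (p t) t) (hp : ∀ t, HasDerivAt p (-g (q t)) t)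
    {s u : ℝ} (hs : s ∈ Set.Icc 0 h) (hu : u ∈ Set.Icc 0 h) :
    ‖q s - (q 0 + u • p 0)‖ ≤ 2 * h * (‖p 0‖ + L * h * ‖q 0‖) := by
  have hqc : Continuous q := continuous_iff_continuousAt.2 fun t => (hq t).continuousAt
  obtain ⟨m, hm, hmax⟩ := isCompact_Icc.exists_isMaxOn (Set.nonempty_Icc.2 hh.le)
    hqc.norm.continuousOn
  have hM : ∀ t ∈ Set.Icc 0 h, ‖q t‖ ≤ ‖q m‖ := fun t ht => hmax ht
  have hpb : ∀ t ∈ Set.Icc 0 h, ‖p t - p 0‖ ≤ L * ‖q m‖ * h := by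
    intro t ht
    have := norm_image_sub_le_of_norm_deriv_le_segment' (f := p) (C := L * ‖q m‖)
      (fun r _ => (hp r).hasDerivWithinAt)
      (fun r hr => by
        rw [norm_neg]
        exact (hg _).trans (mul_le_mul_of_nonneg_left (hM r ⟨hr.1, hr.2.le⟩) hL.le)) t ht
    refine this.trans (mul_le_mul_of_nonneg_left ?_ (by positivity))
    linarith [ht.2]
  have hqb : ∀ t ∈ Set.Icc 0 h, ‖q t - q 0 - t • p 0‖ ≤ L * ‖q m‖ * h * h := by
    intro t ht
    have hd : ∀ r, HasDerivAt (fun r => q r - r • p 0) (p r - p 0) r := fun r => by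
      simpa using (hq r).fun_sub ((hasDerivAt_id r).smul_const (p 0))
    have := norm_image_sub_le_of_norm_deriv_le_segment' (C := L * ‖q m‖ * h)
      (fun r _ => (hd r).hasDerivWithinAt) (fun r hr => hpb r ⟨hr.1, hr.2.le⟩) t ht
    simp only [zero_smul, sub_zero, sub_right_comm] at this
    refine this.trans (mul_le_mul_of_nonneg_left ht.2 (by positivity))
  have hsmall : L * ‖q m‖ * h * h ≤ ‖q m‖ / 144 := by
    nlinarith [mul_le_mul_of_nonneg_right hLh (norm_nonneg (q m))]
  have hqm : ‖q m‖ ≤ 2 * (‖q 0‖ + h * ‖p 0‖) - ‖q m‖ / 2 := by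
    have htri : ‖q m‖ ≤ ‖q m - q 0 - m • p 0‖ + ‖q 0‖ + ‖m • p 0‖ := by
      calc ‖q m‖ = ‖(q m - q 0 - m • p 0) + q 0 + m • p 0‖ := by congr 1; abel
        _ ≤ _ := norm_add₃_le
    have hmp : ‖m • p 0‖ ≤ h * ‖p 0‖ := by
      rw [norm_smul, Real.norm_of_nonneg hm.1]
      exact mul_le_mul_of_nonneg_right hm.2 (norm_nonneg _)
    have := hqb m hm
    have := norm_nonneg (q 0)
    have : 0 ≤ h * ‖p 0‖ := by positivity
    linarith
  have hsu : ‖(s - u) • p 0‖ ≤ h * ‖p 0‖ := by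
    rw [norm_smul]
    refine mul_le_mul_of_nonneg_right ?_ (norm_nonneg _)
    rw [Real.norm_eq_abs, abs_le]
    constructor <;> linarith [hs.1, hs.2, hu.1, hu.2]
  have hdec : q s - (q 0 + u • p 0) = (q s - q 0 - s • p 0) + (s - u) • p 0 := by
    rw [sub_smul]; abel
  have hfin : ‖q s - (q 0 + u • p 0)‖ ≤ L * ‖q m‖ * h * h + h * ‖p 0‖ := by
    rw [hdec]
    exact (norm_add_le _ _).trans (add_le_add (hqb s hs) hsu)
  have hA : L * h ^ 2 * ‖q m‖ ≤ L * h ^ 2 * (2 * (‖q 0‖ + h * ‖p 0‖)) :=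
    mul_le_mul_of_nonneg_left (by linarith [norm_nonneg (q m)]) (by positivity)
  have hB : L * h ^ 2 * (h * ‖p 0‖) ≤ 1 / 144 * (h * ‖p 0‖) :=
    mul_le_mul_of_nonneg_right hLh (by positivity)
  have : 0 ≤ h * ‖p 0‖ := by positivity
  linarith

/-- **Mean-square bound on the discretization error of the force along one step**
(from the proof of Lemma B.4, eq. (B.14)): under A1–A2 with `L^{1/2}·h ≤ 1/12`, with
`F = -∇U`, `F_𝒰 = F(x + 𝒰·v)`, `F₁ = (2/h²)∫₀ʰ (h-s)F(q_s) ds`,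
`F₂ = (1/h)∫₀ʰ F(q_s) ds`, one has
`max(E|F₁ - F_𝒰|², E|F₂ - F_𝒰|²) ≤ 11·L²·h²·(L²·h²·|x|² + |v|²)`. -/
theorem force_discretization_mse
    (U : EuclideanSpace ℝ (Fin d) → ℝ)
    (gU : EuclideanSpace ℝ (Fin d) → EuclideanSpace ℝ (Fin d)) (L : ℝ) (hL : 0 < L)
    (hgrad : ∀ x, HasGradientAt U (gU x) x)
    (hU0 : U 0 = 0) (hUmin : ∀ x, U 0 ≤ U x)
    (hLip : ∀ x y, ‖gU x - gU y‖ ≤ L * ‖x - y‖)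
    (h : ℝ) (hh : 0 < h) (hLh : Real.sqrt L * h ≤ 1 / 12)
    (x v : EuclideanSpace ℝ (Fin d))
    (q p : ℝ → EuclideanSpace ℝ (Fin d)) (hq0 : q 0 = x) (hp0 : p 0 = v)
    (hq : ∀ t, HasDerivAt q (p t) t) (hp : ∀ t, HasDerivAt p (-gU (q t)) t)
 :
    max
      (∫ u, ‖(2 / h ^ 2) • (∫ s in Set.Ioc (0 : ℝ) h, (h - s) • (-gU (q s))) -
          (-gU (x + u • v))‖ ^ 2 ∂(unif0h h))
      (∫ u, ‖h⁻¹ • (∫ s in Set.Ioc (0 : ℝ) h, -gU (q s)) -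
          (-gU (x + u • v))‖ ^ 2 ∂(unif0h h))
      ≤ 11 * L ^ 2 * h ^ 2 * (L ^ 2 * h ^ 2 * ‖x‖ ^ 2 + ‖v‖ ^ 2) := by
  have hg0 : gU 0 = 0 := (hgrad 0).eq_zero_of_forall_le hUmin
  have hg : ∀ y, ‖gU y‖ ≤ L * ‖y‖ := fun y => by simpa [hg0] using hLip y 0
  have hLh2 : L * h ^ 2 ≤ 1 / 144 := by
    have := pow_le_pow_left₀ (by positivity) hLh 2
    rw [mul_pow, Real.sq_sqrt hL.le] at this
    linarith
  have hgc : Continuous gU :=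
    (LipschitzWith.of_dist_le_mul (K := ⟨L, hL.le⟩) fun x y => by
      rw [dist_eq_norm, dist_eq_norm]
      exact hLip x y).continuous
  have hqc : Continuous q := continuous_iff_continuousAt.2 fun t => (hq t).continuousAt
  have hfc : Continuous fun s => -gU (q s) := (hgc.comp hqc).neg
  set C : ℝ := L * (2 * h * (‖v‖ + L * h * ‖x‖)) with hC
  have hforce : ∀ u ∈ Set.Ioo 0 h, ∀ s ∈ Set.Ioc 0 h,
      ‖-gU (q s) - -gU (x + u • v)‖ ≤ C := by
    intro u hu s hs
    have hflow := norm_hamiltonian_sub_transport_le hL hg hh hLh2 hq hp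
      (Set.Ioc_subset_Icc_self hs) (Set.Ioo_subset_Icc_self hu)
    rw [hq0, hp0] at hflow
    rw [neg_sub_neg, norm_sub_rev]
    exact (hLip _ _).trans (mul_le_mul_of_nonneg_left hflow hL.le)
  have hw1 : ∫ s in Set.Ioc 0 h, 2 / h ^ 2 * (h - s) = 1 := by
    rw [← intervalIntegral.integral_of_le hh.le, intervalIntegral.integral_const_mul,
      intervalIntegral.integral_sub (by simp) (by simp)]
    simp
    field_simp
    ring
  have hw2 : ∫ _s in Set.Ioc 0 h, h⁻¹ = 1 := by
    simp [hh.le, hh.ne']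
  have hCsq : C ^ 2 ≤ 11 * L ^ 2 * h ^ 2 * (L ^ 2 * h ^ 2 * ‖x‖ ^ 2 + ‖v‖ ^ 2) := by
    have h1 : 0 ≤ (L * h) ^ 2 * (‖v‖ - L * h * ‖x‖) ^ 2 := by positivity
    have h2 : 0 ≤ (L * h) ^ 2 * (L ^ 2 * h ^ 2 * ‖x‖ ^ 2 + ‖v‖ ^ 2) := by positivity
    rw [hC]
    linarith
  refine max_le ((integral_unif0h_norm_sq_le hh fun u hu => ?_).trans hCsq)
    ((integral_unif0h_norm_sq_le hh fun u hu => ?_).trans hCsq)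
  · rw [← integral_smul]
    simp only [smul_smul]
    exact norm_setIntegral_smul_sub_le (by fun_prop) hfc
      (fun s hs => mul_nonneg (by positivity) (by linarith [hs.2])) hw1 (hforce u hu)
  · rw [← integral_smul]
    exact norm_setIntegral_smul_sub_le continuous_const hfc
      (fun s hs => by positivity) hw2 (hforce u hu)

end
end
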